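/- Suppose f : E → ℝ is locally Lipschitz and is a strong C² max function at x̄ with data f₁, …, f_n. Then f has tempered growth at x̄ relative to the active manifold M: for every angle θ ∈ (0, π/2) there exists β̄ > 0 such that for every β ∈ (0, β̄] the following holds. For every sequence of points x_r → x̄ with x_r ≠ x̄, every sequence of radii ε_r with 0 ≤ ε_r ≤ β·‖x_r − x̄‖ such that g_{ε_r}(x_r) → 0, and every choice of nearest points y_r ∈ M of x_r (i.e. y_r ∈ M with ‖x_r − y_r‖ = dist(x_r, M)), one has for all sufficiently large r: g_{ε_r}(x_r) ≠ 0, p(y_r) ≠ 0, and ⟨g_{ε_r}(x_r), p(y_r)⟩ ≥ cos(θ)·‖g_{ε_r}(x_r)‖·‖p(y_r)‖. -/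

import Mathlib

open Filter Topology Metric Set
open scoped Classical

variable {E : Type*} [NormedAddCommGroup E] [InnerProductSpace ℝ E] [FiniteDimensional ℝ E]

/-- The Clarke subdifferential: the closed convex hull of all limits of gradients
along sequences of points of differentiability converging to `x`. -/
noncomputable def clarkeSubdiff (f : E → ℝ) (x : E) : Set E :=
  closure (convexHull ℝ {v : E | ∃ u : ℕ → E,
    (∀ n, DifferentiableAt ℝ f (u n)) ∧
    Tendsto u atTop (𝓝 x) ∧
    Tendsto (fun n => gradient f (u n)) atTop (𝓝 v)})

/-- The Goldstein subdifferential of radius `ε`. -/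
noncomputable def goldsteinSubdiff (f : E → ℝ) (x : E) (ε : ℝ) : Set E :=
  convexHull ℝ (⋃ y ∈ Metric.closedBall x ε, clarkeSubdiff f y)

/-- The element of minimal norm of a set (junk value `0` if no minimizer exists). -/
noncomputable def minNorm (s : Set E) : E :=
  if h : ∃ v, v ∈ s ∧ ∀ w ∈ s, ‖v‖ ≤ ‖w‖ then h.choose else 0

/-- The Goldstein subgradient: the minimal-norm element of the Goldstein subdifferential. -/
noncomputable def goldsteinGrad (f : E → ℝ) (x : E) (ε : ℝ) : E :=
  minNorm (goldsteinSubdiff f x ε)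

/-- The Goldstein modulus `Γf(x) = inf {ε ≥ 0 : ‖g_ε(x)‖ ≤ ε}`. -/
noncomputable def goldsteinModulus (f : E → ℝ) (x : E) : ℝ :=
  sInf {ε : ℝ | 0 ≤ ε ∧ ‖goldsteinGrad f x ε‖ ≤ ε}

open scoped RealInnerProductSpace

/-- `f` is a strong `C²` max function at `xbar` with data `F 0, …, F n`. -/
def IsStrongC2MaxAt (f : E → ℝ) (xbar : E) {n : ℕ} (F : Fin (n + 1) → E → ℝ) : Prop :=
  (∀ i, ContDiff ℝ 2 (F i)) ∧
  (∃ ρ > 0, ∀ x : E, ‖x - xbar‖ ≤ ρ →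
      f x = Finset.univ.sup' Finset.univ_nonempty (fun i => F i x)) ∧
  (∀ i j, F i xbar = F j xbar) ∧
  AffineIndependent ℝ (fun i => gradient (F i) xbar) ∧
  (0 : E) ∈ intrinsicInterior ℝ (convexHull ℝ (Set.range fun i => gradient (F i) xbar)) ∧
  (∃ δ > 0, ∃ ρ' > 0, ∀ x : E, ‖x - xbar‖ ≤ ρ' → f x - f xbar ≥ δ / 2 * ‖x - xbar‖ ^ 2)

lemma IsCompact.convexHull_of_finiteDimensional {s : Set E} (hs : IsCompact s) :
    IsCompact (convexHull ℝ s) := by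
  rcases s.eq_empty_or_nonempty with rfl | ⟨a, ha⟩
  · simp
  set d := Module.finrank ℝ E
  have hK : IsCompact (stdSimplex ℝ (Fin (d + 1)) ×ˢ Set.univ.pi fun _ : Fin (d + 1) => s) :=
    (isCompact_stdSimplex _ _).prod (isCompact_univ_pi fun _ => hs)
  have hc : Continuous fun q : (Fin (d + 1) → ℝ) × (Fin (d + 1) → E) => ∑ i, q.1 i • q.2 i := by
    fun_prop
  convert hK.image hc
  ext v
  constructor
  · intro hv
    obtain ⟨ι, _, z, w, hz, haff, hw, hw1, hv⟩ := eq_pos_convex_span_of_mem_convexHull hv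
    have hcard : Fintype.card ι ≤ Fintype.card (Fin (d + 1)) := by
      rw [Fintype.card_fin]
      exact haff.card_le_finrank_succ.trans
        (Nat.succ_le_succ (Submodule.finrank_le _))
    obtain ⟨e⟩ := Function.Embedding.nonempty_of_card_le hcard
    refine ⟨(Function.extend e w 0, Function.extend e z fun _ => a), ⟨⟨fun j => ?_, ?_⟩, ?_⟩, ?_⟩
    · by_cases hj : ∃ i, e i = j
      · obtain ⟨i, rfl⟩ := hj
        simpa [e.injective.extend_apply] using (hw i).le
      · simp [Function.extend_apply' _ _ _ hj]
    · rw [← hw1]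
      refine (Fintype.sum_of_injective e e.injective _ _ (fun j hj => ?_) fun i => ?_).symm
      · exact Function.extend_apply' _ _ _ hj
      · simp [e.injective.extend_apply]
    · intro j _
      by_cases hj : ∃ i, e i = j
      · obtain ⟨i, rfl⟩ := hj
        simpa [e.injective.extend_apply] using hz ⟨i, rfl⟩
      · simpa [Function.extend_apply' _ _ _ hj] using ha
    · rw [← hv]
      refine (Fintype.sum_of_injective e e.injective _ _ (fun j hj => ?_) fun i => ?_).symm
      · simp [Function.extend_apply' (f := e) w 0 j hj]
      · simp [e.injective.extend_apply]
  · rintro ⟨⟨w, z⟩, ⟨⟨hw, hw1⟩, hz⟩, rfl⟩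
    exact (convex_convexHull ℝ s).sum_mem (fun i _ => hw i) hw1
      fun i _ => subset_convexHull ℝ s (hz i (mem_univ i))

lemma minNorm_spec {s : Set E} (hs : IsCompact s) (hne : s.Nonempty) :
    minNorm s ∈ s ∧ ∀ w ∈ s, ‖minNorm s‖ ≤ ‖w‖ := by
  have h : ∃ v, v ∈ s ∧ ∀ w ∈ s, ‖v‖ ≤ ‖w‖ := by
    obtain ⟨v, hv, hmin⟩ := hs.exists_isMinOn hne continuous_norm.continuousOn
    exact ⟨v, hv, fun w hw => hmin hw⟩
  rw [minNorm, dif_pos h]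
  exact h.choose_spec

lemma sq_norm_le_inner_of_norm_minimal {s : Set E} (hs : Convex ℝ s) {v : E} (hv : v ∈ s)
    (hmin : ∀ w ∈ s, ‖v‖ ≤ ‖w‖) {w : E} (hw : w ∈ s) : ‖v‖ ^ 2 ≤ ⟪v, w⟫ := by
  by_contra! h
  have h1 : ∀ t : ℝ, 0 < t → t ≤ 1 → 0 ≤ 2 * (⟪v, w⟫ - ‖v‖ ^ 2) + t * ‖w - v‖ ^ 2 := by
    intro t ht ht1
    have hm := hmin _ (hs.add_smul_sub_mem hv hw ⟨ht.le, ht1⟩)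
    have h2 : ‖v‖ ^ 2 ≤ ‖v + t • (w - v)‖ ^ 2 := by gcongr
    rw [norm_add_sq_real, inner_smul_right, norm_smul, inner_sub_right,
      real_inner_self_eq_norm_sq, mul_pow, Real.norm_eq_abs, sq_abs] at h2
    have h3 : 0 ≤ t * (2 * (⟪v, w⟫ - ‖v‖ ^ 2) + t * ‖w - v‖ ^ 2) := by nlinarith
    exact nonneg_of_mul_nonneg_right h3 ht
  have h2 := ge_of_tendsto (f := fun t : ℝ => 2 * (⟪v, w⟫ - ‖v‖ ^ 2) + t * ‖w - v‖ ^ 2)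
    (x := 𝓝[>] 0) (a := 2 * (⟪v, w⟫ - ‖v‖ ^ 2) + 0 * ‖w - v‖ ^ 2) (b := 0)
    (by
      apply Filter.Tendsto.mono_left _ nhdsWithin_le_nhds
      exact Continuous.tendsto (by fun_prop) _)
    (by
      filter_upwards [Ioc_mem_nhdsGT (show (0 : ℝ) < 1 by norm_num)] with t ht
      exact h1 t ht.1 ht.2)
  linarith

/-- The set of limits of gradients of `f` along sequences converging to `x`. -/
def limitingGradients (f : E → ℝ) (x : E) : Set E :=
  {v | (x, v) ∈ closure {q : E × E | DifferentiableAt ℝ f q.1 ∧ q.2 = gradient f q.1}}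

lemma clarkeSubdiff_eq (f : E → ℝ) (x : E) :
    clarkeSubdiff f x = closure (convexHull ℝ (limitingGradients f x)) := by
  unfold clarkeSubdiff
  congr 2
  ext v
  simp only [limitingGradients, mem_ofPred_eq, mem_closure_iff_seq_limit]
  constructor
  · rintro ⟨u, hd, hu, hv⟩
    exact ⟨fun n => (u n, gradient f (u n)), fun n => ⟨hd n, rfl⟩, hu.prodMk_nhds hv⟩
  · rintro ⟨q, hq, hlim⟩
    have := (Prod.tendsto_iff _ _).1 hlim
    refine ⟨fun n => (q n).1, fun n => (hq n).1, this.1, ?_⟩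
    simpa only [← (hq _).2] using this.2

lemma gradient_eq_of_eventually_le {f g : E → ℝ} {x : E} (hf : DifferentiableAt ℝ f x)
    (hg : DifferentiableAt ℝ g x) (hle : ∀ᶠ z in 𝓝 x, g z ≤ f z) (heq : f x = g x) :
    gradient f x = gradient g x := by
  have hmin : IsLocalMin (f - g) x := by
    filter_upwards [hle] with z hz
    simp only [Pi.sub_apply]
    linarith
  have h0 := hmin.hasFDerivAt_eq_zero (hf.hasFDerivAt.sub hg.hasFDerivAt)
  rw [gradient, gradient, sub_eq_zero.1 h0]

section MaxFunction

variable {n : ℕ} {f : E → ℝ} {F : Fin (n + 1) → E → ℝ} {xbar : E} {ρ : ℝ}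

lemma ContDiff.continuous_gradient {g : E → ℝ} {k : WithTop ℕ∞} (hg : ContDiff ℝ k g)
    (hk : k ≠ 0) : Continuous (gradient g) :=
  (InnerProductSpace.toDual ℝ E).symm.continuous.comp (hg.continuous_fderiv hk)

lemma exists_active_gradient_eq (hF : ∀ i, ContDiff ℝ 2 (F i))
    (hmax : ∀ x : E, ‖x - xbar‖ ≤ ρ →
      f x = Finset.univ.sup' Finset.univ_nonempty (fun i => F i x))
    {u : E} (hu : u ∈ ball xbar ρ) (hd : DifferentiableAt ℝ f u) :
    ∃ i, (∀ j, F j u ≤ F i u) ∧ gradient f u = gradient (F i) u := by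
  have hmem : ∀ z ∈ ball xbar ρ, ‖z - xbar‖ ≤ ρ := fun z hz => (mem_ball_iff_norm.1 hz).le
  obtain ⟨i, -, hi⟩ := Finset.exists_mem_eq_sup' (s := (Finset.univ : Finset (Fin (n + 1))))
    Finset.univ_nonempty (fun i => F i u)
  refine ⟨i, fun j => ?_, gradient_eq_of_eventually_le hd
    ((hF i).differentiable (by norm_num) u) ?_ ?_⟩
  · rw [← hi]
    exact Finset.le_sup' (fun i => F i u) (Finset.mem_univ j)
  · filter_upwards [isOpen_ball.mem_nhds hu] with z hz
    rw [hmax z (hmem z hz)]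
    exact Finset.le_sup' (fun i => F i z) (Finset.mem_univ i)
  · rw [hmax u (hmem u hu), hi]

lemma exists_active_of_mem_limitingGradients (hF : ∀ i, ContDiff ℝ 2 (F i))
    (hmax : ∀ x : E, ‖x - xbar‖ ≤ ρ →
      f x = Finset.univ.sup' Finset.univ_nonempty (fun i => F i x))
    {z v : E} (hz : z ∈ ball xbar ρ) (hv : v ∈ limitingGradients f z) :
    ∃ i, (∀ j, F j z ≤ F i z) ∧ v = gradient (F i) z := by
  have hclosed : IsClosed (⋃ i, {q : E × E | (∀ j, F j q.1 ≤ F i q.1) ∧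
      q.2 = gradient (F i) q.1}) := by
    refine isClosed_iUnion_of_finite fun i => ?_
    have hG := (hF i).continuous_gradient (by norm_num)
    have hc := fun j => (hF j).continuous
    have h1 : IsClosed {q : E × E | ∀ j, F j q.1 ≤ F i q.1} := by
      simp only [ofPred_forall]
      exact isClosed_iInter fun j =>
        isClosed_le ((hc j).comp continuous_fst) ((hc i).comp continuous_fst)
    exact h1.inter (isClosed_eq continuous_snd (hG.comp continuous_fst))
  obtain ⟨q, hq, hlim⟩ := mem_closure_iff_seq_limit.1 hv
  have hq1 := ((Prod.tendsto_iff _ _).1 hlim).1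
  have hmem := hclosed.mem_of_tendsto hlim (by
    filter_upwards [hq1.eventually (isOpen_ball.mem_nhds hz)] with k hk
    obtain ⟨i, hi, hg⟩ := exists_active_gradient_eq hF hmax hk (hq k).1
    exact mem_iUnion.2 ⟨i, hi, (hq k).2.trans hg⟩)
  exact mem_iUnion.1 hmem

lemma LocallyLipschitz.dense_differentiableAt (hf : LocallyLipschitz f) :
    Dense {x | DifferentiableAt ℝ f x} := by
  let _ : MeasurableSpace E := borel E
  have : BorelSpace E := ⟨rfl⟩
  rw [Metric.dense_iff]
  intro x r hr
  obtain ⟨K, t, ht, hK⟩ := hf x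
  have hae := hK.ae_differentiableWithinAt_of_mem (μ := MeasureTheory.Measure.addHaar)
  have hdense := MeasureTheory.Measure.dense_of_ae hae
  obtain ⟨u, hu, hu'⟩ := hdense.inter_open_nonempty (interior t ∩ ball x r)
    (isOpen_interior.inter isOpen_ball)
    ⟨x, mem_interior_iff_mem_nhds.2 ht, mem_ball_self hr⟩
  exact ⟨u, hu.2, (hu' (interior_subset hu.1)).differentiableAt (mem_interior_iff_mem_nhds.1 hu.1)⟩

lemma limitingGradients_nonempty (hf : LocallyLipschitz f) (hF : ∀ i, ContDiff ℝ 2 (F i))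
    (hmax : ∀ x : E, ‖x - xbar‖ ≤ ρ →
      f x = Finset.univ.sup' Finset.univ_nonempty (fun i => F i x))
    {x : E} (hx : x ∈ ball xbar ρ) : (limitingGradients f x).Nonempty := by
  obtain ⟨u, hu, hux⟩ := mem_closure_iff_seq_limit.1 (hf.dense_differentiableAt x)
  have hK : IsCompact (⋃ i, (fun z => (z, gradient (F i) z)) '' closedBall xbar ρ) :=
    isCompact_iUnion fun i => (isCompact_closedBall _ _).image
      (continuous_id.prodMk ((hF i).continuous_gradient (by norm_num)))
  have hev : ∀ᶠ k in atTop, (u k, gradient f (u k)) ∈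
      ⋃ i, (fun z => (z, gradient (F i) z)) '' closedBall xbar ρ := by
    filter_upwards [hux.eventually (isOpen_ball.mem_nhds hx)] with k hk
    obtain ⟨i, -, hi⟩ := exists_active_gradient_eq hF hmax hk (hu k)
    exact mem_iUnion.2 ⟨i, u k, ball_subset_closedBall hk, by simp only [hi]⟩
  obtain ⟨⟨a, b⟩, -, φ, hφ, hlim⟩ := hK.tendsto_subseq' hev.frequently
  have hlim' := (Prod.tendsto_iff _ _).1 hlim
  obtain rfl : a = x := tendsto_nhds_unique hlim'.1 (hux.comp hφ.tendsto_atTop)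
  exact ⟨b, mem_closure_iff_seq_limit.2
    ⟨fun k => (u (φ k), gradient f (u (φ k))), fun k => ⟨hu (φ k), rfl⟩, hlim⟩⟩

lemma goldsteinSubdiff_eq (hF : ∀ i, ContDiff ℝ 2 (F i))
    (hmax : ∀ x : E, ‖x - xbar‖ ≤ ρ →
      f x = Finset.univ.sup' Finset.univ_nonempty (fun i => F i x))
    {x : E} {ε : ℝ} (hx : closedBall x ε ⊆ ball xbar ρ) :
    goldsteinSubdiff f x ε = convexHull ℝ (⋃ z ∈ closedBall x ε, limitingGradients f z) := by
  have hcl : ∀ z ∈ closedBall x ε, clarkeSubdiff f z = convexHull ℝ (limitingGradients f z) := by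
    intro z hz
    rw [clarkeSubdiff_eq]
    refine IsClosed.closure_eq (Set.Finite.isClosed_convexHull (𝕜 := ℝ) ?_)
    refine (Set.finite_range fun i => gradient (F i) z).subset fun v hv => ?_
    obtain ⟨i, -, rfl⟩ := exists_active_of_mem_limitingGradients hF hmax (hx hz) hv
    exact mem_range_self i
  refine Subset.antisymm (convexHull_min (iUnion₂_subset fun z hz => ?_) (convex_convexHull _ _))
    (convexHull_mono (iUnion₂_mono fun z hz => ?_))
  · rw [hcl z hz]
    exact convexHull_mono (subset_biUnion_of_mem (u := limitingGradients f) hz)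
  · rw [hcl z hz]
    exact subset_convexHull _ _

lemma isCompact_goldsteinSubdiff (hF : ∀ i, ContDiff ℝ 2 (F i))
    (hmax : ∀ x : E, ‖x - xbar‖ ≤ ρ →
      f x = Finset.univ.sup' Finset.univ_nonempty (fun i => F i x))
    {x : E} {ε : ℝ} (hx : closedBall x ε ⊆ ball xbar ρ) :
    IsCompact (goldsteinSubdiff f x ε) := by
  rw [goldsteinSubdiff_eq hF hmax hx]
  refine IsCompact.convexHull_of_finiteDimensional ?_
  set Γ := closure {q : E × E | DifferentiableAt ℝ f q.1 ∧ q.2 = gradient f q.1}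
  have hK : IsCompact (⋃ i, (fun z => (z, gradient (F i) z)) '' closedBall x ε) :=
    isCompact_iUnion fun i => (isCompact_closedBall _ _).image
      (continuous_id.prodMk ((hF i).continuous_gradient (by norm_num)))
  have hK' : IsCompact (Γ ∩ Prod.fst ⁻¹' closedBall x ε) := by
    refine hK.of_isClosed_subset
      (isClosed_closure.inter (isClosed_closedBall.preimage continuous_fst)) ?_
    rintro ⟨z, v⟩ ⟨hv, hz⟩
    obtain ⟨i, -, hi⟩ := exists_active_of_mem_limitingGradients hF hmax (hx hz) hv
    exact mem_iUnion.2 ⟨i, z, hz, Prod.ext rfl hi.symm⟩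
  convert hK'.image continuous_snd
  ext v
  simp only [mem_iUnion, exists_prop, Set.mem_image, Prod.exists, exists_eq_right]
  exact exists_congr fun z => and_comm

lemma goldsteinGrad_spec (hf : LocallyLipschitz f) (hF : ∀ i, ContDiff ℝ 2 (F i))
    (hmax : ∀ x : E, ‖x - xbar‖ ≤ ρ →
      f x = Finset.univ.sup' Finset.univ_nonempty (fun i => F i x))
    {x : E} {ε : ℝ} (hε : 0 ≤ ε) (hx : closedBall x ε ⊆ ball xbar ρ) :
    goldsteinGrad f x ε ∈ goldsteinSubdiff f x ε ∧
      ∀ w ∈ goldsteinSubdiff f x ε, ‖goldsteinGrad f x ε‖ ≤ ‖w‖ := by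
  refine minNorm_spec (isCompact_goldsteinSubdiff hF hmax hx) ?_
  have hxx := mem_closedBall_self (x := x) hε
  obtain ⟨v, hv⟩ := limitingGradients_nonempty hf hF hmax (hx hxx)
  rw [goldsteinSubdiff_eq hF hmax hx]
  exact ⟨v, subset_convexHull _ _ (mem_biUnion hxx hv)⟩

end MaxFunction

lemma exists_weights_of_mem_convexHull_range {ι : Type*} [Fintype ι] {g : ι → E} {v : E}
    (hv : v ∈ convexHull ℝ (range g)) :
    ∃ w : ι → ℝ, (∀ i, 0 ≤ w i) ∧ ∑ i, w i = 1 ∧ ∑ i, w i • g i = v := by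
  have hsub : convexHull ℝ (range g) ⊆ Fintype.linearCombination ℝ g '' stdSimplex ℝ ι := by
    refine convexHull_min ?_ ((convex_stdSimplex ℝ ι).linear_image _)
    rintro _ ⟨i, rfl⟩
    exact ⟨Pi.single i 1, single_mem_stdSimplex ℝ i, by simp⟩
  obtain ⟨w, ⟨hw, hw1⟩, rfl⟩ := hsub hv
  exact ⟨w, hw, hw1, rfl⟩

lemma exists_pos_weights_of_zero_mem_intrinsicInterior {ι : Type*} [Fintype ι] [Nonempty ι]
    {g : ι → E} (h : (0 : E) ∈ intrinsicInterior ℝ (convexHull ℝ (range g))) :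
    ∃ w : ι → ℝ, (∀ i, 0 < w i) ∧ ∑ i, w i = 1 ∧ ∑ i, w i • g i = 0 := by
  obtain ⟨y, hy, hy0⟩ := mem_intrinsicInterior.1 h
  have key : ∀ i, ∃ w : ι → ℝ, (∀ j, 0 ≤ w j) ∧ 0 < w i ∧ ∑ j, w j • g j = 0 := by
    intro i
    have hgi : g i ∈ affineSpan ℝ (convexHull ℝ (range g)) :=
      subset_affineSpan _ _ (subset_convexHull _ _ (mem_range_self i))
    have h0 : (0 : E) ∈ affineSpan ℝ (convexHull ℝ (range g)) := hy0 ▸ y.2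
    have hline : ∀ t : ℝ, t • g i ∈ affineSpan ℝ (convexHull ℝ (range g)) := fun t => by
      simpa [AffineMap.lineMap_apply] using AffineMap.lineMap_mem t h0 hgi
    have hcont : Continuous fun t : ℝ =>
        (⟨t • g i, hline t⟩ : affineSpan ℝ (convexHull ℝ (range g))) := by fun_prop
    have hev : ∀ᶠ t : ℝ in 𝓝 0, t • g i ∈ convexHull ℝ (range g) := by
      have h1 : (⟨(0 : ℝ) • g i, hline 0⟩ : affineSpan ℝ (convexHull ℝ (range g))) = y :=
        Subtype.ext (by simp [hy0])
      have h2 := hcont.tendsto 0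
      rw [h1] at h2
      exact h2.eventually (mem_interior_iff_mem_nhds.1 hy)
    obtain ⟨t, ht, ht0⟩ := ((hev.filter_mono nhdsWithin_le_nhds).and
      (self_mem_nhdsWithin (s := Iio (0 : ℝ)))).exists
    obtain ⟨w, hw, -, hwt⟩ := exists_weights_of_mem_convexHull_range ht
    refine ⟨fun j => w j + (Pi.single i (-t) : ι → ℝ) j, fun j => add_nonneg (hw j) ?_, ?_, ?_⟩
    · exact (Pi.single_nonneg.2 (by linarith) : (0 : ι → ℝ) ≤ Pi.single i (-t)) j
    · have := hw i
      simp only [Pi.single_eq_same]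
      linarith
    · simp only [add_smul, Finset.sum_add_distrib, hwt, Pi.single_apply, ite_smul, zero_smul,
        Finset.sum_ite_eq', Finset.mem_univ, if_true, neg_smul, add_neg_cancel]
  choose w hw hwi hw0 using key
  have hpos : ∀ j, 0 < ∑ i, w i j := fun j =>
    Finset.sum_pos' (fun i _ => hw i j) ⟨j, Finset.mem_univ j, hwi j⟩
  have hS : 0 < ∑ j, ∑ i, w i j := Finset.sum_pos (fun j _ => hpos j) Finset.univ_nonempty
  refine ⟨fun j => (∑ k, ∑ i, w i k)⁻¹ * ∑ i, w i j, fun j => mul_pos (inv_pos.2 hS) (hpos j),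
    ?_, ?_⟩
  · rw [← Finset.mul_sum, inv_mul_cancel₀ hS.ne']
  · simp only [mul_smul, ← Finset.smul_sum, Finset.sum_smul]
    have : ∑ j, ∑ i, w i j • g j = 0 := by
      rw [Finset.sum_comm]
      exact Finset.sum_eq_zero fun i _ => hw0 i
    rw [this, smul_zero]

lemma AffineIndependent.exists_abs_le_mul_norm_sum {ι : Type*} [Fintype ι] {g : ι → E}
    (hg : AffineIndependent ℝ g) :
    ∃ K > 0, ∀ w : ι → ℝ, ∑ i, w i = 0 → ∀ i, |w i| ≤ K * ‖∑ i, w i • g i‖ := by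
  let T : (ι → ℝ) →ₗ[ℝ] ℝ × E :=
    (Fintype.linearCombination ℝ fun _ : ι => (1 : ℝ)).prod (Fintype.linearCombination ℝ g)
  have hT : ∀ w, T w = (∑ i, w i, ∑ i, w i • g i) := fun w => by
    simp [T, Fintype.linearCombination_apply]
  have hker : T.ker = ⊥ := by
    rw [LinearMap.ker_eq_bot']
    intro w hw
    rw [hT, Prod.mk_eq_zero] at hw
    ext i
    exact affineIndependent_iff.1 hg Finset.univ w hw.1 hw.2 i (Finset.mem_univ i)
  obtain ⟨K, hK0, hK⟩ := T.exists_antilipschitzWith hker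
  refine ⟨K, by exact_mod_cast hK0, fun w hw i => ?_⟩
  have h1 := hK.le_mul_dist w 0
  rw [map_zero, dist_zero_right, dist_zero_right, hT, hw] at h1
  have h2 : ‖((0 : ℝ), ∑ i, w i • g i)‖ = ‖∑ i, w i • g i‖ := by simp [Prod.norm_def]
  rw [h2] at h1
  exact (norm_le_pi_norm w i).trans h1

lemma AffineIndependent.pi_inner_surjective {n : ℕ} {g : Fin (n + 1) → E}
    (hg : AffineIndependent ℝ g) :
    (ContinuousLinearMap.pi fun k : Fin n => innerSL ℝ (g k.succ - g 0)).range = ⊤ := by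
  by_contra hne
  obtain ⟨φ, hφ0, hφ⟩ := Submodule.exists_le_ker_of_lt_top _ (lt_top_iff_ne_top.2 hne)
  have hφs : ∀ u : Fin n → ℝ, φ u = ∑ k, u k * φ (Pi.single k 1) := fun u => by
    conv_lhs => rw [pi_eq_sum_univ' u]
    simp only [map_sum, map_smul, smul_eq_mul]
  have hsum : ∑ k : Fin n, φ (Pi.single k 1) • (g k.succ - g 0) = 0 := by
    refine ext_inner_right ℝ fun v => ?_
    have h1 := hφ ⟨v, rfl⟩
    rw [LinearMap.mem_ker, hφs] at h1
    rw [inner_zero_left, sum_inner, ← h1]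
    refine Finset.sum_congr rfl fun k _ => ?_
    rw [real_inner_smul_left, mul_comm]
    rfl
  let w : Fin (n + 1) → ℝ := Fin.cons (-∑ k, φ (Pi.single k 1)) fun k => φ (Pi.single k 1)
  have hw := affineIndependent_iff.1 hg Finset.univ w
    (by simp [w, Fin.sum_univ_succ]) (by
      rw [Fin.sum_univ_succ]
      simp only [w, Fin.cons_zero, Fin.cons_succ]
      rw [← hsum]
      simp only [smul_sub, Finset.sum_sub_distrib, Finset.sum_smul, neg_smul]
      abel)
  refine hφ0 (LinearMap.ext fun u => ?_)
  rw [hφs]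
  refine Finset.sum_eq_zero fun k _ => ?_
  have := hw k.succ (Finset.mem_univ _)
  simp only [w, Fin.cons_succ] at this
  rw [this, mul_zero]

lemma exists_infDist_le_mul {n : ℕ} {F : Fin (n + 1) → E → ℝ} {xbar : E}
    (hF : ∀ i, ContDiff ℝ 2 (F i))
    (hg : AffineIndependent ℝ fun i => gradient (F i) xbar) :
    ∃ C > 0, ∃ ρ > 0, ∀ x ∈ ball xbar ρ, ∀ a, 0 ≤ a → a ≤ ρ →
      (∀ i j, F i x - F j x ≤ a) → infDist x {z : E | ∀ i j, F i z = F j z} ≤ C * a := by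
  set Φ : E → Fin n → ℝ := fun x k => F k.succ x - F 0 x
  set Φ' : E →L[ℝ] Fin n → ℝ :=
    ContinuousLinearMap.pi fun k => innerSL ℝ (gradient (F k.succ) xbar - gradient (F 0) xbar)
  have hfd : ∀ i, HasStrictFDerivAt (F i) (innerSL ℝ (gradient (F i) xbar)) xbar := fun i => by
    have h1 := (hF i).contDiffAt.hasStrictFDerivAt (x := xbar) (by norm_num)
    have h2 : innerSL ℝ (gradient (F i) xbar) = fderiv ℝ (F i) xbar :=
      ContinuousLinearMap.ext fun v => inner_gradient_left
    rwa [h2]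
  have hΦ : HasStrictFDerivAt Φ Φ' xbar := by
    refine hasStrictFDerivAt_pi'.2 fun k => ?_
    have := (hfd k.succ).sub (hfd 0)
    rw [← map_sub] at this
    exact this
  let S := Φ'.nonlinearRightInverseOfSurjective hg.pi_inner_surjective
  have hS : 0 < S.nnnorm := Φ'.nonlinearRightInverseOfSurjective_nnnorm_pos _
  obtain ⟨s, hs, happ⟩ := hΦ.approximates_deriv_on_nhds (c := S.nnnorm⁻¹ / 2)
    (Or.inr (by positivity))
  obtain ⟨r, hr, hrs⟩ := Metric.mem_nhds_iff.1 hs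
  set C : ℝ := 2 * S.nnnorm
  have hC : 0 < C := by positivity
  refine ⟨C, hC, r / (2 * (1 + C)), by positivity, fun x hx a ha0 ha hFa => ?_⟩
  have hball : closedBall x (C * a) ⊆ s := by
    refine (closedBall_subset_ball' ?_).trans hrs
    have h1 : dist x xbar < r / (2 * (1 + C)) := hx
    have h2 : C * a ≤ C * (r / (2 * (1 + C))) := by gcongr
    have h3 : (1 + C) * (r / (2 * (1 + C))) = r / 2 := by field_simp
    linarith
  have hsurj := happ.surjOn_closedBall_of_nonlinearRightInverse S (by positivity) hball
  have h0 : (0 : Fin n → ℝ) ∈ closedBall (Φ x) (((S.nnnorm : ℝ)⁻¹ - (S.nnnorm⁻¹ / 2 : NNReal)) *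
      (C * a)) := by
    have h1 : ((S.nnnorm : ℝ)⁻¹ - (S.nnnorm⁻¹ / 2 : NNReal)) * (C * a) = a := by
      have : (0 : ℝ) < S.nnnorm := hS
      simp only [C, NNReal.coe_div, NNReal.coe_inv, NNReal.coe_ofNat]
      field_simp
      ring
    rw [h1, mem_closedBall, dist_comm, dist_zero_right, pi_norm_le_iff_of_nonneg ha0]
    intro k
    rw [Real.norm_eq_abs, abs_le]
    have := hFa k.succ 0
    have := hFa 0 k.succ
    constructor <;> simp only [Φ] <;> linarith
  obtain ⟨z, hz, hz0⟩ := hsurj h0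
  have hzM : z ∈ {z : E | ∀ i j, F i z = F j z} := by
    have h1 : ∀ i, F i z = F 0 z := by
      intro i
      refine Fin.cases rfl (fun k => ?_) i
      exact sub_eq_zero.1 (congrFun hz0 k)
    exact fun i j => (h1 i).trans (h1 j).symm
  calc infDist x _ ≤ dist x z := infDist_le_dist_of_mem hzM
    _ ≤ C * a := by rw [dist_comm]; exact hz

lemma ContDiff.gradient_of_two {h : E → ℝ} (hh : ContDiff ℝ 2 h) : ContDiff ℝ 1 (gradient h) :=
  (InnerProductSpace.toDual ℝ E).symm.contDiff.comp (hh.fderiv_right (by norm_num))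

lemma exists_common_lipschitz {ι : Type*} [Fintype ι] {X : Type*} [NormedAddCommGroup X]
    [NormedSpace ℝ X] {h : ι → E → X} (hh : ∀ i, ContDiff ℝ 1 (h i)) (xbar : E) :
    ∃ L > 0, ∃ ρ > 0, ∀ i, ∀ u ∈ ball xbar ρ, ∀ v ∈ ball xbar ρ,
      ‖h i u - h i v‖ ≤ L * ‖u - v‖ := by
  have h1 : ∀ i, ∃ K : NNReal, ∃ t ∈ 𝓝 xbar, LipschitzOnWith K (h i) t := fun i =>
    (hh i).contDiffAt.exists_lipschitzOnWith
  choose K t ht hK using h1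
  obtain ⟨ρ, hρ, hρt⟩ := Metric.mem_nhds_iff.1 (Filter.iInter_mem.2 ht)
  refine ⟨∑ i, (K i : ℝ) + 1, by positivity, ρ, hρ, fun i u hu v hv => ?_⟩
  refine ((hK i).norm_sub_le (mem_iInter.1 (hρt hu) i) (mem_iInter.1 (hρt hv) i)).trans ?_
  gcongr
  have : (K i : ℝ) ≤ ∑ i, (K i : ℝ) :=
    Finset.single_le_sum (f := fun i => (K i : ℝ)) (fun i _ => (K i).2) (Finset.mem_univ i)
  linarith

lemma exists_mul_sq_le_inner_gradient {h : E → ℝ} (hh : ContDiff ℝ 2 h) {xbar : E}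
    (hcrit : gradient h xbar = 0) {δ : ℝ} (hδ : 0 < δ) :
    ∃ ρ > 0, ∀ y ∈ ball xbar ρ, δ / 2 * ‖y - xbar‖ ^ 2 ≤ h y - h xbar →
      δ / 2 * ‖y - xbar‖ ^ 2 ≤ ⟪gradient h y, y - xbar⟫ := by
  have hd : HasFDerivAt (gradient h) (fderiv ℝ (gradient h) xbar) xbar :=
    (hh.gradient_of_two.differentiable (by norm_num) xbar).hasFDerivAt
  set H := fderiv ℝ (gradient h) xbar
  have hη : 0 < δ / 6 := by positivity
  obtain ⟨ρ, hρ, hρH⟩ := Metric.eventually_nhds_iff_ball.1 (hd.isLittleO.def hη)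
  refine ⟨ρ, hρ, fun y hy hgrow => ?_⟩
  set d := y - xbar with hd_def
  have hnear : ∀ t ∈ Icc (0 : ℝ) 1,
      |⟪gradient h (xbar + t • d), d⟫ - t * ⟪H d, d⟫| ≤ δ / 6 * ‖d‖ ^ 2 := by
    intro t ht
    have hnorm : ‖t • d‖ ≤ ‖d‖ := by
      rw [norm_smul, Real.norm_eq_abs, abs_of_nonneg ht.1]
      exact mul_le_of_le_one_left (norm_nonneg _) ht.2
    have hmem : xbar + t • d ∈ ball xbar ρ := by
      rw [mem_ball_iff_norm, add_sub_cancel_left]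
      exact hnorm.trans_lt (mem_ball_iff_norm.1 hy)
    have h1 := hρH _ hmem
    rw [hcrit, sub_zero, add_sub_cancel_left, map_smul] at h1
    have h2 : ⟪gradient h (xbar + t • d), d⟫ - t * ⟪H d, d⟫ =
        ⟪gradient h (xbar + t • d) - t • H d, d⟫ := by
      rw [inner_sub_left, real_inner_smul_left]
    rw [h2]
    calc _ ≤ ‖gradient h (xbar + t • d) - t • H d‖ * ‖d‖ := abs_real_inner_le_norm _ _
      _ ≤ δ / 6 * ‖d‖ * ‖d‖ := by
        gcongr
        exact h1.trans (by gcongr)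
      _ = _ := by ring
  have hderiv : ∀ t ∈ Icc (0 : ℝ) 1,
      HasDerivWithinAt (fun t : ℝ => h (xbar + t • d) - t ^ 2 / 2 * ⟪H d, d⟫)
        (⟪gradient h (xbar + t • d), d⟫ - t * ⟪H d, d⟫) (Icc 0 1) t := by
    intro t _
    have h1 : HasDerivAt (fun t : ℝ => xbar + t • d) d t := by
      simpa using ((hasDerivAt_id t).smul_const d).const_add xbar
    have h2 := ((hh.differentiable (by norm_num) (xbar + t • d)).hasFDerivAt).comp_hasDerivAt t h1
    rw [← inner_gradient_left] at h2
    have h3 : HasDerivAt (fun t : ℝ => t ^ 2 / 2 * ⟪H d, d⟫) (t * ⟪H d, d⟫) t := by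
      refine (((hasDerivAt_pow 2 t).div_const 2).mul_const ⟪H d, d⟫).congr_deriv ?_
      norm_num
    exact (h2.sub h3).hasDerivWithinAt
  have hmvt := norm_image_sub_le_of_norm_deriv_le_segment_01' hderiv
    fun t ht => hnear t (Ico_subset_Icc_self ht)
  have h1 := hnear 1 (by simp)
  have hy' : xbar + d = y := by simp [hd_def]
  simp only [one_smul, zero_smul, add_zero, hy', Real.norm_eq_abs] at hmvt h1
  have h2 := (abs_le.1 hmvt).2
  have h3 := (abs_le.1 h1).1
  nlinarith

lemma abs_inner_gradient_sub_le {h : E → ℝ} (hh : Differentiable ℝ h) {xbar y : E} {L ρ : ℝ}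
    (hL : ∀ u ∈ ball xbar ρ, ∀ v ∈ ball xbar ρ, ‖gradient h u - gradient h v‖ ≤ L * ‖u - v‖)
    (hL0 : 0 ≤ L) (hy : y ∈ ball xbar ρ) :
    |⟪gradient h y, y - xbar⟫ - (h y - h xbar)| ≤ L * ‖y - xbar‖ ^ 2 := by
  have hρ : 0 < ρ := pos_of_mem_ball hy
  have hseg : ∀ z ∈ segment ℝ xbar y, ‖fderiv ℝ h z - fderiv ℝ h y‖ ≤ L * ‖y - xbar‖ := by
    intro z hz
    have hzρ := (convex_ball xbar ρ).segment_subset (mem_ball_self hρ) hy hz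
    rw [← toDual_gradient, ← toDual_gradient, ← map_sub, LinearIsometryEquiv.norm_map]
    refine (hL z hzρ y hy).trans ?_
    gcongr
    rw [← dist_eq_norm, ← dist_eq_norm]
    have := dist_add_dist_of_mem_segment hz
    have := dist_nonneg (x := xbar) (y := z)
    rw [dist_comm y xbar]
    linarith
  have h1 := (convex_segment xbar y).norm_image_sub_le_of_norm_fderiv_le'
    (fun z _ => hh z) hseg (left_mem_segment ℝ xbar y) (right_mem_segment ℝ xbar y)
  rw [← inner_gradient_left, Real.norm_eq_abs, abs_sub_comm] at h1
  calc _ ≤ _ := h1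
    _ = _ := by ring

section Weights

variable {ι : Type*} [Fintype ι]

lemma norm_sum_smul_sub_le {w : ι → ℝ} (hw : ∀ i, 0 ≤ w i) (hw1 : ∑ i, w i = 1) {a b : ι → E}
    {κ : ℝ} (hab : ∀ i, ‖a i - b i‖ ≤ κ) : ‖∑ i, w i • a i - ∑ i, w i • b i‖ ≤ κ := by
  rw [← Finset.sum_sub_distrib]
  calc ‖∑ i, (w i • a i - w i • b i)‖ ≤ ∑ i, w i * κ := by
        refine norm_sum_le_of_le _ fun i _ => ?_
        rw [← smul_sub, norm_smul, Real.norm_eq_abs, abs_of_nonneg (hw i)]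
        exact mul_le_mul_of_nonneg_left (hab i) (hw i)
    _ = κ := by rw [← Finset.sum_mul, hw1, one_mul]

lemma exists_weights_of_mem_convexHull_iUnion {A : ι → Set E} {b : ι → E} {κ : ℝ}
    (hA : ∀ i, ∀ a ∈ A i, ‖a - b i‖ ≤ κ) {v : E} (hv : v ∈ convexHull ℝ (⋃ i, A i)) :
    ∃ w : ι → ℝ, (∀ i, 0 ≤ w i) ∧ ∑ i, w i = 1 ∧ (∀ i, w i ≠ 0 → (A i).Nonempty) ∧
      ‖v - ∑ i, w i • b i‖ ≤ κ := by
  refine convexHull_min (s := ⋃ i, A i) (t := {v | ∃ w : ι → ℝ, (∀ i, 0 ≤ w i) ∧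
    ∑ i, w i = 1 ∧ (∀ i, w i ≠ 0 → (A i).Nonempty) ∧ ‖v - ∑ i, w i • b i‖ ≤ κ}) ?_ ?_ hv
  · refine iUnion_subset fun i a ha => ⟨Pi.single i 1, ?_, by simp, fun j hj => ?_, ?_⟩
    · exact (Pi.single_nonneg.2 zero_le_one : (0 : ι → ℝ) ≤ Pi.single i 1)
    · obtain rfl : j = i := by
        by_contra h
        exact hj (Pi.single_eq_of_ne h 1)
      exact ⟨a, ha⟩
    · have : ∑ j, (Pi.single i 1 : ι → ℝ) j • b j = b i := by
        simp [Pi.single_apply]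
      rw [this]
      exact hA i a ha
  · rintro u ⟨w, hw, hw1, hwA, hu⟩ u' ⟨w', hw', hw1', hwA', hu'⟩ s t hs ht hst
    refine ⟨fun i => s * w i + t * w' i, fun i => by have := hw i; have := hw' i; positivity,
      ?_, fun i hi => ?_, ?_⟩
    · rw [Finset.sum_add_distrib, ← Finset.mul_sum, ← Finset.mul_sum, hw1, hw1']
      linarith
    · by_cases h : w i = 0
      · refine hwA' i fun h' => hi ?_
        simp [h, h']
      · exact hwA i h
    · have h1 : s • u + t • u' - ∑ i, (s * w i + t * w' i) • b i =
          s • (u - ∑ i, w i • b i) + t • (u' - ∑ i, w' i • b i) := by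
        simp only [add_smul, mul_smul, Finset.sum_add_distrib, ← Finset.smul_sum, smul_sub]
        abel
      rw [h1]
      calc _ ≤ s * κ + t * κ := by
            refine norm_add_le_of_le ?_ ?_
            · rw [norm_smul, Real.norm_eq_abs, abs_of_nonneg hs]
              gcongr
            · rw [norm_smul, Real.norm_eq_abs, abs_of_nonneg ht]
              gcongr
        _ = κ := by rw [← add_mul, hst, one_mul]

lemma abs_weight_sub_le {a b : ι → E} {K κ : ℝ} (hK0 : 0 ≤ K)
    (hK : ∀ w : ι → ℝ, ∑ i, w i = 0 → ∀ i, |w i| ≤ K * ‖∑ i, w i • a i‖)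
    {l : ι → ℝ} (hl1 : ∑ i, l i = 1) (hla : ∑ i, l i • a i = 0) (hab : ∀ i, ‖b i - a i‖ ≤ κ)
    {w : ι → ℝ} (hw : ∀ i, 0 ≤ w i) (hw1 : ∑ i, w i = 1) (i : ι) :
    |w i - l i| ≤ K * (‖∑ i, w i • b i‖ + κ) := by
  have h1 := hK (fun i => w i - l i) (by rw [Finset.sum_sub_distrib, hw1, hl1, sub_self]) i
  refine h1.trans ?_
  gcongr
  simp only [sub_smul, Finset.sum_sub_distrib, hla, sub_zero]
  have h2 := norm_sum_smul_sub_le hw hw1 hab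
  have h3 := norm_sub_norm_le (∑ i, w i • a i) (∑ i, w i • b i)
  rw [norm_sub_rev] at h3
  linarith

lemma minNorm_convexHull_range_spec [Nonempty ι] (b : ι → E) :
    minNorm (convexHull ℝ (range b)) ∈ convexHull ℝ (range b) ∧
      ∀ w ∈ convexHull ℝ (range b), ‖minNorm (convexHull ℝ (range b))‖ ≤ ‖w‖ :=
  minNorm_spec ((finite_range b).isCompact_convexHull (𝕜 := ℝ)) (range_nonempty b).convexHull

lemma inner_minNorm_eq_of_pos [Nonempty ι] {b : ι → E} {w : ι → ℝ} (hw : ∀ i, 0 < w i)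
    (hw1 : ∑ i, w i = 1) (hwb : ∑ i, w i • b i = minNorm (convexHull ℝ (range b))) (i : ι) :
    ⟪b i, minNorm (convexHull ℝ (range b))⟫ = ‖minNorm (convexHull ℝ (range b))‖ ^ 2 := by
  set p := minNorm (convexHull ℝ (range b))
  obtain ⟨hp, hmin⟩ := minNorm_convexHull_range_spec b
  have hge : ∀ j, 0 ≤ w j * (⟪b j, p⟫ - ‖p‖ ^ 2) := fun j => by
    refine mul_nonneg (hw j).le (sub_nonneg.2 ?_)
    rw [real_inner_comm]
    exact sq_norm_le_inner_of_norm_minimal (convex_convexHull _ _) hp hmin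
      (subset_convexHull _ _ (mem_range_self j))
  have hsum : ∑ j, w j * (⟪b j, p⟫ - ‖p‖ ^ 2) = 0 := by
    simp only [mul_sub, Finset.sum_sub_distrib, ← Finset.sum_mul, hw1, one_mul]
    have h : ⟪∑ j, w j • b j, p⟫ = ‖p‖ ^ 2 := by rw [hwb, real_inner_self_eq_norm_sq]
    simp only [sum_inner, real_inner_smul_left] at h
    rw [h, sub_self]
  have := (Finset.sum_eq_zero_iff_of_nonneg fun j _ => hge j).1 hsum i (Finset.mem_univ i)
  have := (mul_eq_zero.1 this).resolve_left (hw i).ne'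
  linarith

end Weights

lemma gradient_sum_mul {ι : Type*} [Fintype ι] {F : ι → E → ℝ} (hF : ∀ i, Differentiable ℝ (F i))
    (l : ι → ℝ) (z : E) :
    gradient (fun z => ∑ i, l i * F i z) z = ∑ i, l i • gradient (F i) z := by
  have h : HasFDerivAt (fun z => ∑ i, l i * F i z) (∑ i, l i • fderiv ℝ (F i) z) z :=
    HasFDerivAt.fun_sum fun i _ => (hF i z).hasFDerivAt.const_mul (l i)
  refine ext_inner_right ℝ fun v => ?_
  rw [inner_gradient_left, h.fderiv, sum_inner]
  simp [real_inner_smul_left, inner_gradient_left]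

lemma exists_minNorm_gradient_bounds {n : ℕ} {F : Fin (n + 1) → E → ℝ} {xbar : E}
    (hF : ∀ i, ContDiff ℝ 2 (F i)) (heq : ∀ i j, F i xbar = F j xbar)
    (hg : AffineIndependent ℝ fun i => gradient (F i) xbar)
    {l : Fin (n + 1) → ℝ} (hl : ∀ i, 0 < l i) (hl1 : ∑ i, l i = 1)
    (hlg : ∑ i, l i • gradient (F i) xbar = 0) {δ ρ₀ : ℝ} (hδ : 0 < δ) (hρ₀ : 0 < ρ₀)
    (hgrow : ∀ y ∈ ball xbar ρ₀, (∀ i j, F i y = F j y) →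
      δ / 2 * ‖y - xbar‖ ^ 2 ≤ F 0 y - F 0 xbar) :
    ∃ c > 0, ∃ ρ > 0, ∀ y ∈ ball xbar ρ, (∀ i j, F i y = F j y) →
      c * ‖y - xbar‖ ≤ ‖minNorm (convexHull ℝ (range fun i => gradient (F i) y))‖ ∧
      ∃ w : Fin (n + 1) → ℝ, (∀ i, 0 < w i) ∧ ∑ i, w i = 1 ∧
        ∑ i, w i • gradient (F i) y =
          minNorm (convexHull ℝ (range fun i => gradient (F i) y)) := by
  have hdiff : ∀ i, Differentiable ℝ (F i) := fun i => (hF i).differentiable (by norm_num)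
  obtain ⟨K, hK0, hK⟩ := hg.exists_abs_le_mul_norm_sum
  obtain ⟨L, hL0, ρL, hρL, hL⟩ :=
    exists_common_lipschitz (fun i => (hF i).gradient_of_two) xbar
  have hh : ContDiff ℝ 2 fun z => ∑ i, l i * F i z :=
    ContDiff.sum fun i _ => contDiff_const.mul (hF i)
  obtain ⟨ρH, hρH, hH⟩ := exists_mul_sq_le_inner_gradient hh
    ((gradient_sum_mul hdiff l xbar).trans hlg) hδ
  obtain ⟨i₀, hi₀⟩ := Finite.exists_min l
  set m := l i₀
  have hm : 0 < m := hl i₀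
  set ρ₁ : ℝ := m / (2 * K * L + 1) with hρ₁
  set ρ₂ : ℝ := δ / (4 * ((n + 1) * (2 * K * L) * L)) with hρ₂
  refine ⟨δ / 4, by positivity, min (min ρ₀ ρL) (min ρH (min ρ₁ ρ₂)), by positivity,
    fun y hy hyM => ?_⟩
  have hyρ : ‖y - xbar‖ < min (min ρ₀ ρL) (min ρH (min ρ₁ ρ₂)) := mem_ball_iff_norm.1 hy
  simp only [lt_min_iff] at hyρ
  obtain ⟨⟨hy0, hyL⟩, hyH, hy1, hy2⟩ := hyρ
  set d := ‖y - xbar‖ with hd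
  have hd0 : 0 ≤ d := norm_nonneg _
  have hab : ∀ i, ‖gradient (F i) y - gradient (F i) xbar‖ ≤ L * d := fun i =>
    hL i y (mem_ball_iff_norm.2 hyL) xbar (mem_ball_self hρL)
  set p := minNorm (convexHull ℝ (range fun i => gradient (F i) y)) with hp_def
  obtain ⟨hp, hmin⟩ := minNorm_convexHull_range_spec fun i => gradient (F i) y
  obtain ⟨w, hw, hw1, hwp⟩ := exists_weights_of_mem_convexHull_range hp
  replace hwp : ∑ i, w i • gradient (F i) y = p := hwp
  have hpn : ‖p‖ ≤ L * d := by
    have h1 := hmin (∑ i, l i • gradient (F i) y) ((convex_convexHull ℝ _).sum_mem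
      (fun i _ => (hl i).le) hl1 fun i _ => subset_convexHull _ _ (mem_range_self i))
    have h2 := norm_sum_smul_sub_le (fun i => (hl i).le) hl1 hab
    rw [hlg, sub_zero] at h2
    exact h1.trans h2
  have hclose : ∀ i, |w i - l i| ≤ 2 * K * L * d := fun i => by
    have h1 := abs_weight_sub_le hK0.le hK hl1 hlg hab hw hw1 i
    rw [hwp] at h1
    refine h1.trans ?_
    calc K * (‖p‖ + L * d) ≤ K * (L * d + L * d) := by gcongr
      _ = _ := by ring
  refine ⟨?_, w, fun i => ?_, hw1, hwp⟩
  · have hs : ∀ i, F i y - F i xbar = F 0 y - F 0 xbar := fun i => by rw [hyM i 0, heq i 0]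
    have hHy := hH y (mem_ball_iff_norm.2 hyH) (by
      have : ∑ i, l i * F i y - ∑ i, l i * F i xbar = F 0 y - F 0 xbar := by
        rw [← Finset.sum_sub_distrib]
        simp only [← mul_sub, hs]
        rw [← Finset.sum_mul, hl1, one_mul]
      rw [this]
      exact hgrow y (mem_ball_iff_norm.2 hy0) hyM)
    rw [gradient_sum_mul hdiff] at hHy
    have hsplit : ⟪p, y - xbar⟫ = ⟪∑ i, l i • gradient (F i) y, y - xbar⟫ +
        ∑ i, (w i - l i) * (⟪gradient (F i) y, y - xbar⟫ - (F i y - F i xbar)) := by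
      simp only [hs, mul_sub, Finset.sum_sub_distrib, sub_mul, ← Finset.sum_mul, hw1, hl1]
      have h : ⟪p, y - xbar⟫ = ⟪∑ i, w i • gradient (F i) y, y - xbar⟫ := by rw [hwp]
      rw [h]
      simp only [sum_inner, real_inner_smul_left]
      ring
    have herr : |∑ i, (w i - l i) * (⟪gradient (F i) y, y - xbar⟫ - (F i y - F i xbar))| ≤
        (n + 1) * (2 * K * L) * L * d * d ^ 2 := by
      refine (Finset.abs_sum_le_sum_abs _ _).trans ?_
      calc _ ≤ ∑ _i : Fin (n + 1), (2 * K * L * d) * (L * d ^ 2) := by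
            refine Finset.sum_le_sum fun i _ => ?_
            rw [abs_mul]
            gcongr
            · exact hclose i
            · exact abs_inner_gradient_sub_le (hdiff i) (hL i) hL0.le (mem_ball_iff_norm.2 hyL)
        _ = _ := by
            simp only [Finset.sum_const, Finset.card_univ, Fintype.card_fin, nsmul_eq_mul]
            push_cast
            ring
    have hsmall : (n + 1) * (2 * K * L) * L * d ≤ δ / 4 := by
      rw [hρ₂, lt_div_iff₀ (by positivity)] at hy2
      linarith
    have h1 : δ / 4 * d ^ 2 ≤ ⟪p, y - xbar⟫ := by
      have := (abs_le.1 herr).1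
      have : (n + 1) * (2 * K * L) * L * d * d ^ 2 ≤ δ / 4 * d ^ 2 := by gcongr
      linarith
    have h2 : ⟪p, y - xbar⟫ ≤ ‖p‖ * d := real_inner_le_norm _ _
    rcases hd0.eq_or_lt with h0 | hdpos
    · rw [← h0, mul_zero]
      exact norm_nonneg _
    · refine le_of_mul_le_mul_right ?_ hdpos
      linarith
  · rw [hρ₁, lt_div_iff₀ (by positivity)] at hy1
    have := (abs_le.1 (hclose i)).1
    have := hi₀ i
    nlinarith

lemma angle_of_norm_sub_le {g p q : E} {τ c : ℝ} (hp : p ≠ 0) (hqp : ⟪q, p⟫ = ‖p‖ ^ 2)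
    (hgq : ‖g - q‖ ≤ τ * ‖p‖) (hg : ‖g‖ ≤ ‖p‖ + τ * ‖p‖) (hc0 : 0 ≤ c) (hc1 : c < 1)
    (hτ : τ ≤ (1 - c) / 2) : g ≠ 0 ∧ c * ‖g‖ * ‖p‖ ≤ ⟪g, p⟫ := by
  have hp0 : 0 < ‖p‖ := norm_pos_iff.2 hp
  have h1 : (1 - τ) * ‖p‖ ^ 2 ≤ ⟪g, p⟫ := by
    have h2 : ⟪g, p⟫ = ⟪q, p⟫ + ⟪g - q, p⟫ := by rw [inner_sub_left]; ring
    have h3 := (abs_le.1 (abs_real_inner_le_norm (g - q) p)).1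
    have h4 : ‖g - q‖ * ‖p‖ ≤ τ * ‖p‖ * ‖p‖ := by gcongr
    rw [h2, hqp]
    linarith
  have h5 : 0 < ⟪g, p⟫ := lt_of_lt_of_le (mul_pos (by linarith) (by positivity)) h1
  refine ⟨fun h => by simp [h] at h5, ?_⟩
  calc c * ‖g‖ * ‖p‖ ≤ c * (‖p‖ + τ * ‖p‖) * ‖p‖ := by gcongr
    _ = c * (1 + τ) * ‖p‖ ^ 2 := by ring
    _ ≤ (1 - τ) * ‖p‖ ^ 2 := by
      gcongr
      nlinarith [sq_nonneg (1 - c)]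
    _ ≤ _ := h1

set_option maxHeartbeats 800000 in
/-- The local form of tempered growth: the angle estimate holds at every point near `xbar` whose
Goldstein subgradient is small. -/
lemma IsStrongC2MaxAt.exists_forall_angle_le {f : E → ℝ} (hf : LocallyLipschitz f) {xbar : E}
    {n : ℕ} {F : Fin (n + 1) → E → ℝ} (h : IsStrongC2MaxAt f xbar F) {c₀ : ℝ} (hc0 : 0 ≤ c₀)
    (hc1 : c₀ < 1) :
    ∃ betabar > 0, ∃ η > 0, ∀ β ≤ betabar, ∀ x : E, x ≠ xbar → ‖x - xbar‖ < η →
      ∀ ε, 0 ≤ ε → ε ≤ β * ‖x - xbar‖ → ‖goldsteinGrad f x ε‖ < η →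
      ∀ y, (∀ i j, F i y = F j y) → ‖x - y‖ = infDist x {z : E | ∀ i j, F i z = F j z} →
      goldsteinGrad f x ε ≠ 0 ∧
        minNorm (convexHull ℝ (range fun i => gradient (F i) y)) ≠ 0 ∧
        c₀ * ‖goldsteinGrad f x ε‖ *
          ‖minNorm (convexHull ℝ (range fun i => gradient (F i) y))‖ ≤
        ⟪goldsteinGrad f x ε, minNorm (convexHull ℝ (range fun i => gradient (F i) y))⟫ := by
  obtain ⟨hF, ⟨ρ, hρ, hmax⟩, heq, hg, hint, δ, hδ, ρ', hρ', hgrow⟩ := h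
  obtain ⟨l, hl, hl1, hlg⟩ := exists_pos_weights_of_zero_mem_intrinsicInterior hint
  obtain ⟨K, hK0, hK⟩ := hg.exists_abs_le_mul_norm_sum
  obtain ⟨L₁, hL₁0, ρ₁, hρ₁, hL₁⟩ :=
    exists_common_lipschitz (fun i => (hF i).gradient_of_two) xbar
  obtain ⟨L₂, hL₂0, ρ₂, hρ₂, hL₂⟩ :=
    exists_common_lipschitz (fun i => (hF i).of_le (m := 1) (by norm_num)) xbar
  obtain ⟨C, hC0, ρC, hρC, hC⟩ := exists_infDist_le_mul hF hg
  have hval : ∀ z, ‖z - xbar‖ ≤ ρ → (∀ i j, F i z = F j z) → f z = F 0 z := fun z hz hzM => by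
    rw [hmax z hz]
    exact le_antisymm (Finset.sup'_le _ _ fun i _ => (hzM i 0).le)
      (Finset.le_sup' (fun i => F i z) (Finset.mem_univ 0))
  obtain ⟨c, hc, ρp, hρp, hp⟩ := exists_minNorm_gradient_bounds hF heq hg hl hl1 hlg hδ
    (lt_min hρ hρ') fun y hy hyM => by
      have hy' := lt_min_iff.1 (mem_ball_iff_norm.1 hy)
      rw [← hval y hy'.1.le hyM, ← hval xbar (by simpa using hρ.le) heq]
      exact hgrow y hy'.2.le
  obtain ⟨i₀, hi₀⟩ := Finite.exists_min l
  have hm : 0 < l i₀ := hl i₀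
  obtain ⟨L, hL0, hLL₁, hLL₂⟩ : ∃ L > 0, L₁ ≤ L ∧ L₂ ≤ L :=
    ⟨max L₁ L₂, lt_max_of_lt_left hL₁0, le_max_left _ _, le_max_right _ _⟩
  obtain ⟨s, hs0, hsρ, hs1, hs2, hsC, hsp⟩ :
      ∃ s > 0, s ≤ ρ ∧ s ≤ ρ₁ ∧ s ≤ ρ₂ ∧ s ≤ ρC ∧ s ≤ ρp :=
    ⟨min ρ (min ρ₁ (min ρ₂ (min ρC ρp))), by positivity, by simp, by simp, by simp, by simp,
      by simp⟩
  set τ : ℝ := (1 - c₀) / 2 with hτ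
  have hτ0 : 0 < τ := by rw [hτ]; linarith
  refine ⟨min 1 (min (1 / (4 * C * L)) (τ * c / (2 * (L * (1 + 2 * L * C))))), by positivity,
    min (s / (4 * (1 + L))) (l i₀ / (K * (1 + 4 * L))), by positivity,
    fun β hβ x hx hxη ε hε hεβ hgη y hyM hxy => ?_⟩
  simp only [le_min_iff] at hβ
  obtain ⟨hβ1, hβC, hβτ⟩ := hβ
  rw [lt_min_iff] at hxη hgη
  set R := ‖x - xbar‖ with hR
  have hR0 : 0 < R := norm_pos_iff.2 (sub_ne_zero.2 hx)
  rw [le_div_iff₀ (by positivity)] at hβC hβτ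
  have hεR : ε ≤ R := hεβ.trans (mul_le_of_le_one_left hR0.le hβ1)
  have hRs : R * (4 * (1 + L)) < s := (lt_div_iff₀ (by positivity)).1 hxη.1
  have hRL : 0 < R * L := by positivity
  have hyR : ‖x - y‖ ≤ R := by
    rw [hxy, hR, ← dist_eq_norm]
    exact infDist_le_dist_of_mem heq
  have hyxbar : ‖y - xbar‖ ≤ 2 * R := by
    have := norm_sub_le_norm_sub_add_norm_sub y x xbar
    rw [norm_sub_rev y x] at this
    linarith
  have hys : y ∈ ball xbar s := mem_ball_iff_norm.2 (by linarith)
  have hball : closedBall x ε ⊆ ball xbar s := fun z hz => by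
    have h1 := mem_closedBall_iff_norm.1 hz
    have h2 := norm_sub_le_norm_sub_add_norm_sub z x xbar
    exact mem_ball_iff_norm.2 (by linarith)
  have hxx := mem_closedBall_self (x := x) hε
  have hGlip : ∀ i, ∀ u ∈ ball xbar s, ∀ v ∈ ball xbar s,
      ‖gradient (F i) u - gradient (F i) v‖ ≤ L * ‖u - v‖ := fun i u hu v hv =>
    (hL₁ i u (ball_subset_ball hs1 hu) v (ball_subset_ball hs1 hv)).trans (by gcongr)
  have hFlip : ∀ i, ∀ u ∈ ball xbar s, ∀ v ∈ ball xbar s, |F i u - F i v| ≤ L * ‖u - v‖ :=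
    fun i u hu v hv =>
      (hL₂ i u (ball_subset_ball hs2 hu) v (ball_subset_ball hs2 hv)).trans (by gcongr)
  have hballρ := hball.trans (ball_subset_ball hsρ)
  obtain ⟨hgmem, hgmin⟩ := goldsteinGrad_spec hf hF hmax hε hballρ
  have hGold := goldsteinSubdiff_eq hF hmax hballρ
  set g := goldsteinGrad f x ε
  set p := minNorm (convexHull ℝ (range fun i => gradient (F i) y)) with hp_def
  obtain ⟨hcp, π, hπ, hπ1, hπp⟩ := hp y (ball_subset_ball hsp hys) hyM
  -- the limiting gradients on the ball, sorted by an active index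
  set A : Fin (n + 1) → Set E := fun i => {a | ∃ z ∈ closedBall x ε,
    (∀ j, F j z ≤ F i z) ∧ a = gradient (F i) z ∧ a ∈ limitingGradients f z}
  set κ := L * (ε + ‖x - y‖) with hκ
  have hAκ : ∀ i, ∀ a ∈ A i, ‖a - gradient (F i) y‖ ≤ κ := by
    rintro i _ ⟨z, hz, -, rfl, -⟩
    refine (hGlip i z (hball hz) y hys).trans ?_
    rw [hκ]
    gcongr
    exact (norm_sub_le_norm_sub_add_norm_sub z x y).trans
      (by gcongr; exact mem_closedBall_iff_norm.1 hz)
  have hgA : g ∈ convexHull ℝ (⋃ i, A i) := by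
    rw [hGold] at hgmem
    refine convexHull_mono (fun a ha => ?_) hgmem
    simp only [mem_iUnion] at ha ⊢
    obtain ⟨z, hz, ha⟩ := ha
    obtain ⟨i, hi, rfl⟩ := exists_active_of_mem_limitingGradients hF hmax (hballρ hz) ha
    exact ⟨i, z, hz, hi, rfl, ha⟩
  obtain ⟨w, hw, hw1, hwA, hgq⟩ := exists_weights_of_mem_convexHull_iUnion hAκ hgA
  have hκR : κ ≤ 2 * (R * L) := by
    have : L * (ε + ‖x - y‖) ≤ L * (R + R) := by gcongr
    linarith
  -- every index is active somewhere on the ball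
  have hwpos : ∀ i, 0 < w i := fun i => by
    have h1 := (abs_le.1 (abs_weight_sub_le hK0.le hK hl1 hlg (κ := L * (2 * R))
      (fun i => (hGlip i y hys xbar (mem_ball_self hs0)).trans (by gcongr)) hw hw1 i)).1
    have h2 : ‖∑ i, w i • gradient (F i) y‖ ≤ ‖g‖ + 2 * (R * L) :=
      (norm_le_norm_add_norm_sub _ _).trans (by gcongr; exact hgq.trans hκR)
    have h3 : K * (‖∑ i, w i • gradient (F i) y‖ + L * (2 * R)) < l i₀ := by
      have h4 : ‖g‖ + 4 * (R * L) < l i₀ / (K * (1 + 4 * L)) * (1 + 4 * L) := by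
        have h5 := mul_lt_mul_of_pos_right hxη.2 hL0
        have h6 := hgη.2
        generalize l i₀ / (K * (1 + 4 * L)) = X at h5 h6 ⊢
        linarith
      calc _ ≤ K * (‖g‖ + 4 * (R * L)) := 
            mul_le_mul_of_nonneg_left (by linarith) hK0.le
        _ < K * (l i₀ / (K * (1 + 4 * L)) * (1 + 4 * L)) := by gcongr
        _ = l i₀ := by field_simp
    have := hi₀ i
    linarith
  have hAne : ∀ i, (A i).Nonempty := fun i => hwA i (hwpos i).ne'
  choose a ha using hAne
  have hgap : ∀ i j, F i x - F j x ≤ 2 * L * ε := fun i j => by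
    obtain ⟨z, hz, hjz, -, -⟩ := ha j
    have h1 := (abs_le.1 (hFlip i x (hball hxx) z (hball hz))).2
    have h2 := (abs_le.1 (hFlip j x (hball hxx) z (hball hz))).1
    have h3 : L * ‖x - z‖ ≤ L * ε := by
      gcongr
      rw [norm_sub_rev]
      exact mem_closedBall_iff_norm.1 hz
    have := hjz i
    linarith
  have hxyC : ‖x - y‖ ≤ C * (2 * L * ε) := by
    rw [hxy]
    refine hC x (ball_subset_ball hsC (hball hxx)) _ (by positivity) ?_ hgap
    have : L * ε ≤ L * R := by gcongr
    linarith
  have hxyR : ‖x - y‖ ≤ R / 2 := by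
    have : C * (2 * L * ε) ≤ C * (2 * L * (β * R)) := by gcongr
    have : β * (4 * C * L) * R ≤ 1 * R := by gcongr
    linarith
  have hyR2 : R / 2 ≤ ‖y - xbar‖ := by
    have := norm_sub_le_norm_sub_add_norm_sub x y xbar
    linarith
  have hp0 : 0 < ‖p‖ := lt_of_lt_of_le (mul_pos hc (by linarith)) hcp
  have hκp : κ ≤ τ * ‖p‖ :=
    calc κ ≤ L * (ε + C * (2 * L * ε)) := by rw [hκ]; gcongr
      _ = L * (1 + 2 * L * C) * ε := by ring
      _ ≤ L * (1 + 2 * L * C) * (β * R) := by gcongr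
      _ = β * (2 * (L * (1 + 2 * L * C))) * (R / 2) := by ring
      _ ≤ τ * c * (R / 2) := by gcongr
      _ ≤ τ * c * ‖y - xbar‖ := by gcongr
      _ ≤ τ * ‖p‖ := by rw [mul_assoc]; gcongr
  have hqp : ⟪∑ i, w i • gradient (F i) y, p⟫ = ‖p‖ ^ 2 := by
    simp only [sum_inner, real_inner_smul_left]
    simp only [p, inner_minNorm_eq_of_pos hπ hπ1 hπp]
    rw [← Finset.sum_mul, hw1, one_mul]
  have hgp : ‖g‖ ≤ ‖p‖ + κ := by
    have h1 : ∑ i, π i • a i ∈ goldsteinSubdiff f x ε := by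
      rw [hGold]
      refine (convex_convexHull ℝ _).sum_mem (fun i _ => (hπ i).le) hπ1 fun i _ =>
        subset_convexHull _ _ ?_
      obtain ⟨z, hz, -, -, haz⟩ := ha i
      exact mem_biUnion hz haz
    have h2 := norm_sum_smul_sub_le (fun i => (hπ i).le) hπ1 fun i => hAκ i (a i) (ha i)
    rw [hπp] at h2
    have h3 := norm_sub_norm_le (∑ i, π i • a i) p
    linarith [hgmin _ h1]
  obtain ⟨hgne, hangle⟩ := angle_of_norm_sub_le (norm_pos_iff.1 hp0) hqp (hgq.trans hκp)
    (hgp.trans (by gcongr)) hc0 hc1 hτ.le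
  exact ⟨hgne, norm_pos_iff.1 hp0, hangle⟩

theorem stmt18 (f : E → ℝ) (hf : LocallyLipschitz f) (xbar : E) {n : ℕ}
    (F : Fin (n + 1) → E → ℝ) (hF : IsStrongC2MaxAt f xbar F) :
    ∀ θ : ℝ, 0 < θ → θ < Real.pi / 2 →
      ∃ betabar > 0, ∀ β : ℝ, 0 < β → β ≤ betabar →
        ∀ x : ℕ → E, (∀ r : ℕ, x r ≠ xbar) → Tendsto x atTop (𝓝 xbar) →
        ∀ ε : ℕ → ℝ, (∀ r : ℕ, 0 ≤ ε r ∧ ε r ≤ β * ‖x r - xbar‖) →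
        Tendsto (fun r : ℕ => goldsteinGrad f (x r) (ε r)) atTop (𝓝 0) →
        ∀ y : ℕ → E, (∀ r : ℕ, (∀ i j, F i (y r) = F j (y r)) ∧
          ‖x r - y r‖ = Metric.infDist (x r) {z : E | ∀ i j, F i z = F j z}) →
        ∀ᶠ r in atTop,
          goldsteinGrad f (x r) (ε r) ≠ 0 ∧
          minNorm (convexHull ℝ (Set.range fun i => gradient (F i) (y r))) ≠ 0 ∧
          ⟪goldsteinGrad f (x r) (ε r),
              minNorm (convexHull ℝ (Set.range fun i => gradient (F i) (y r)))⟫ ≥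
            Real.cos θ * ‖goldsteinGrad f (x r) (ε r)‖ *
              ‖minNorm (convexHull ℝ (Set.range fun i => gradient (F i) (y r)))‖ := by
  intro θ hθ0 hθ
  have hc0 : 0 ≤ Real.cos θ := (Real.cos_pos_of_mem_Ioo ⟨by linarith, hθ⟩).le
  have hc1 : Real.cos θ < 1 := by
    rw [← Real.cos_zero]
    exact Real.cos_lt_cos_of_nonneg_of_le_pi_div_two le_rfl hθ.le hθ0
  obtain ⟨betabar, hb, η, hη, hmain⟩ := hF.exists_forall_angle_le hf hc0 hc1
  refine ⟨betabar, hb, fun β _ hβ x hx hxlim ε hε hg y hy => ?_⟩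
  have hx0 : Tendsto (fun r => ‖x r - xbar‖) atTop (𝓝 0) := tendsto_iff_norm_sub_tendsto_zero.1 hxlim
  have hg0 : Tendsto (fun r => ‖goldsteinGrad f (x r) (ε r)‖) atTop (𝓝 0) := by
    simpa using hg.norm
  filter_upwards [hx0.eventually_lt_const hη, hg0.eventually_lt_const hη] with r hxr hgr
  exact hmain β hβ (x r) (hx r) hxr (ε r) (hε r).1 (hε r).2 hgr (y r) (hy r).1 (hy r).2
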